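/- For n ≥ 4, the Coxeter polynomial of the extended Dynkin diagram D̃_n equals (t^{n-2} − 1)(t − 1)(t + 1)^2. -/

import Mathlib

open Matrix Polynomial

/-- The Coxeter polynomial of a graph given by its adjacency matrix `A`
(indexed by a linearly ordered finite vertex set), defined as the
characteristic polynomial of the Coxeter matrix `-Ǧ·Ǧ⁻ᵀ`, where `Ǧ` is the
upper triangular Gram matrix of the graph. -/
noncomputable def coxPoly {V : Type} [Fintype V] [LinearOrder V]
    (A : Matrix V V ℤ) : Polynomial ℤ :=
  let G : Matrix V V ℤ := Matrix.of fun i j => if i = j then 1 else if i < j then -A i j else 0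
  (-(G * Gᵀ⁻¹)).charpoly
/-- Adjacency matrix of the extended Dynkin diagram `D̃_n` on `n+1` vertices:
the central path `2 - 3 - ⋯ - (n-2)` (of `n-3` vertices), with two extra
leaves `0, 1` joined to `2` and two extra leaves `n-1, n` joined to `n-2`. -/
def dtAdj (n : ℕ) : Matrix (Fin (n + 1)) (Fin (n + 1)) ℤ :=
  Matrix.of fun i j =>
    if ((i.1 = 0 ∨ i.1 = 1) ∧ j.1 = 2) ∨ ((j.1 = 0 ∨ j.1 = 1) ∧ i.1 = 2) ∨
       (i.1 + 1 = j.1 ∧ 2 ≤ i.1 ∧ j.1 ≤ n - 2) ∨ (j.1 + 1 = i.1 ∧ 2 ≤ j.1 ∧ i.1 ≤ n - 2) ∨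
       (i.1 = n - 2 ∧ (j.1 = n - 1 ∨ j.1 = n)) ∨ (j.1 = n - 2 ∧ (i.1 = n - 1 ∨ i.1 = n))
    then 1 else 0

namespace Matrix

theorem det_eq_of_last_row_col {R : Type*} [CommRing R] {k : ℕ}
    (A : Matrix (Fin (k + 2)) (Fin (k + 2)) R)
    (hrow : ∀ j : Fin k, A (Fin.last _) j.castSucc.castSucc = 0)
    (hcol : ∀ i : Fin k, A i.castSucc.castSucc (Fin.last _) = 0) :
    A.det = A (Fin.last _) (Fin.last _) * (A.submatrix Fin.castSucc Fin.castSucc).det -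
      A (Fin.last _) (Fin.last k).castSucc * A (Fin.last k).castSucc (Fin.last _) *
        (A.submatrix (Fin.castSucc ∘ Fin.castSucc) (Fin.castSucc ∘ Fin.castSucc)).det := by
  have hminor : (A.submatrix (Fin.last _).succAbove (Fin.last k).castSucc.succAbove).det =
      A (Fin.last k).castSucc (Fin.last _) *
        (A.submatrix (Fin.castSucc ∘ Fin.castSucc) (Fin.castSucc ∘ Fin.castSucc)).det := by
    rw [det_succ_column _ (Fin.last k), Fin.sum_univ_castSucc]
    have hcomp : (Fin.last k).castSucc.succAbove ∘ Fin.castSucc =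
        (Fin.castSucc ∘ Fin.castSucc : Fin k → Fin (k + 2)) := by
      funext i
      exact Fin.succAbove_of_castSucc_lt _ _ (by simp [Fin.lt_def])
    simp [hcol, submatrix_submatrix, Fin.succAbove_last, hcomp, ← two_mul, pow_mul]
  rw [det_succ_row _ (Fin.last _), Fin.sum_univ_castSucc, Fin.sum_univ_castSucc, hminor]
  have hsign : ((-1 : R)) ^ (k + 1 + k) = -1 := by
    rw [show k + 1 + k = 2 * k + 1 by ring, pow_succ, pow_mul]; simp
  simp [hrow, Fin.succAbove_last, ← two_mul, pow_mul, hsign]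
  ring

end Matrix

theorem coxPoly_eq_det {V : Type} [Fintype V] [LinearOrder V] (A : Matrix V V ℤ) :
    coxPoly A = (Matrix.of fun i j => if i = j then (X : ℤ[X]) + 1
      else if i < j then -C (A i j) else -X * C (A j i)).det := by
  unfold coxPoly
  set G : Matrix V V ℤ :=
    Matrix.of fun i j => if i = j then 1 else if i < j then -A i j else 0 with hG
  have hdet : Gᵀ.det = 1 := by
    rw [det_transpose, det_of_isUpperTriangular]
    · simp [hG]
    · intro i j hij
      simp only [id] at hij
      simp [hG, hij.ne', hij.not_gt]
  have hmul : G * Gᵀ⁻¹ * Gᵀ = G := by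
    rw [Matrix.mul_assoc, nonsing_inv_mul _ (by simp [hdet]), Matrix.mul_one]
  have hmap : (Gᵀ.map C : Matrix V V ℤ[X]).det = 1 := by
    have := (C : ℤ →+* ℤ[X]).map_det Gᵀ
    rw [hdet, map_one] at this
    exact this.symm
  show (-(G * Gᵀ⁻¹)).charpoly = _
  trans (charmatrix (-(G * Gᵀ⁻¹)) * Gᵀ.map C).det
  · rw [det_mul, hmap, mul_one, charpoly]
  congr 1
  have hchar : charmatrix (-(G * Gᵀ⁻¹)) * Gᵀ.map C =
      (X : ℤ[X]) • Gᵀ.map C + G.map C := by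
    rw [charmatrix, Matrix.sub_mul]
    have : (C : ℤ →+* ℤ[X]).mapMatrix (-(G * Gᵀ⁻¹)) * Gᵀ.map C = -G.map C := by
      rw [map_neg, Matrix.neg_mul]
      congr 1
      rw [← RingHom.mapMatrix_apply, ← RingHom.mapMatrix_apply, ← map_mul, hmul]
    rw [this, sub_neg_eq_add]
    congr 1
    ext1 i j
    simp
  rw [hchar]
  ext1 i j
  rcases lt_trichotomy i j with h | rfl | h
  · simp [hG, h, h.ne, h.ne', h.not_gt]
  · simp [hG]
  · simp [hG, h, h.ne, h.ne', h.not_gt]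

/-- The matrix `t Gᵀ + G` of the infinite tree with leaves `0, 1` joined to `2` and the ray
`2 - 3 - 4 - ⋯`. -/
noncomputable def forkEntry (i j : ℕ) : ℤ[X] :=
  if i = j then X + 1
  else if (i = 0 ∧ j = 2) ∨ (i + 1 = j ∧ 1 ≤ i) then -1
  else if (j = 0 ∧ i = 2) ∨ (j + 1 = i ∧ 1 ≤ j) then -X
  else 0

theorem det_forkEntry (k : ℕ) :
    (Matrix.of fun i j : Fin (k + 2) => forkEntry i j).det = (X + 1) * (X ^ (k + 1) + 1) := by
  induction k using Nat.twoStepInduction with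
  | zero => simp [det_fin_two, forkEntry]
  | one => simp [det_fin_three, forkEntry]; ring
  | more k ih₀ ih₁ =>
    rw [det_eq_of_last_row_col]
    · have e₁ : (Matrix.of fun i j : Fin (k + 4) => forkEntry i j).submatrix
          Fin.castSucc Fin.castSucc = Matrix.of fun i j : Fin (k + 3) => forkEntry i j := rfl
      have e₀ : (Matrix.of fun i j : Fin (k + 4) => forkEntry i j).submatrix
          (Fin.castSucc ∘ Fin.castSucc) (Fin.castSucc ∘ Fin.castSucc) =
          Matrix.of fun i j : Fin (k + 2) => forkEntry i j := rfl
      rw [e₁, e₀, ih₀, ih₁]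
      simp [forkEntry]
      ring
    · intro j
      have := j.2
      simp only [of_apply, Fin.val_last, Fin.val_castSucc, forkEntry]
      rw [if_neg (by omega), if_neg (by omega), if_neg (by omega)]
    · intro i
      have := i.2
      simp only [of_apply, Fin.val_last, Fin.val_castSucc, forkEntry]
      rw [if_neg (by omega), if_neg (by omega), if_neg (by omega)]

/-- The Coxeter polynomial of `D̃_n` is `(t^{n-2} − 1)(t − 1)(t + 1)²` for `n ≥ 4`. -/
theorem coxPoly_dtAdj (n : ℕ) (hn : 4 ≤ n) :
    coxPoly (dtAdj n) = ((X : Polynomial ℤ) ^ (n - 2) - 1) * (X - 1) * (X + 1) ^ 2 := by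
  obtain ⟨m, rfl⟩ : ∃ m, n = m + 4 := ⟨n - 4, by omega⟩
  rw [coxPoly_eq_det]
  set M : Matrix (Fin (m + 5)) (Fin (m + 5)) ℤ[X] := Matrix.of fun i j =>
    if i = j then (X : ℤ[X]) + 1
      else if i < j then -C (dtAdj (m + 4) i j) else -X * C (dtAdj (m + 4) j i) with hM
  have hM_apply (i j : Fin (m + 4)) : M i.castSucc j.castSucc = forkEntry i j := by
    have := i.2
    have := j.2
    simp only [hM, of_apply, dtAdj, forkEntry, Fin.ext_iff, Fin.lt_def, Fin.val_castSucc]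
    split_ifs <;> first | omega | simp
  set u : Fin (m + 5) := (Fin.last (m + 3)).castSucc with hu
  set v : Fin (m + 5) := Fin.last (m + 4) with hv
  have huv : v ≠ u := by simp [hu, hv, Fin.ext_iff]
  have hM_twins : M u v = 0 ∧ M v u = 0 := by
    constructor <;>
    · simp only [hM, hu, hv, of_apply, dtAdj, Fin.ext_iff, Fin.lt_def, Fin.val_castSucc,
        Fin.val_last]
      repeat' split
      all_goals first | omega | simp
  have hM_row (j : Fin (m + 3)) : M v j.castSucc.castSucc = M u j.castSucc.castSucc := by
    have := j.2
    simp only [hM, hu, hv, of_apply, dtAdj, Fin.ext_iff, Fin.lt_def, Fin.val_castSucc,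
      Fin.val_last, or_true, and_true]
    repeat' split
    all_goals first | omega | simp
  have hM_col (i : Fin (m + 3)) : M i.castSucc.castSucc v = M i.castSucc.castSucc u := by
    have := i.2
    simp only [hM, hu, hv, of_apply, dtAdj, Fin.ext_iff, Fin.lt_def, Fin.val_castSucc,
      Fin.val_last, or_true, and_true]
    repeat' split
    all_goals first | omega | simp
  set N := M.updateRow v (M v + (-1 : ℤ[X]) • M u) with hN
  -- Subtracting the twin leaf's row and column makes the last vertex adjacent to its twin only.
  rw [← det_updateRow_add_smul_self M huv (-1), ← hN,
    ← det_updateCol_add_smul_self N huv (-1), det_eq_of_last_row_col]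
  · have e₁ : (N.updateCol v fun k => N k v + (-1 : ℤ[X]) • N k u).submatrix
        Fin.castSucc Fin.castSucc = Matrix.of fun i j : Fin (m + 4) => forkEntry i j := by
      ext1 i j
      simp [hN, hv, updateRow_apply, hM_apply, Fin.castSucc_ne_last]
    have e₀ : (N.updateCol v fun k => N k v + (-1 : ℤ[X]) • N k u).submatrix
        (Fin.castSucc ∘ Fin.castSucc) (Fin.castSucc ∘ Fin.castSucc) =
        Matrix.of fun i j : Fin (m + 3) => forkEntry i j :=
      congrArg (fun B => B.submatrix Fin.castSucc Fin.castSucc) e₁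
    rw [e₁, e₀, det_forkEntry, det_forkEntry]
    have h₁ : M v v = X + 1 := by simp [hM]
    have h₂ : M u u = X + 1 := by simp [hM]
    simp only [← hu, ← hv, hN, updateCol_apply, updateRow_apply]
    simp [huv.symm, h₁, h₂, hM_twins.1, hM_twins.2]
    ring
  · intro j
    have hj : j.castSucc.castSucc ≠ v := Fin.castSucc_ne_last _
    simp [← hv, hN, hj, hM_row]
  · intro i
    have hi : i.castSucc.castSucc ≠ v := Fin.castSucc_ne_last _
    simp [← hv, hN, updateRow_apply, hi, hM_col]
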